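/- arXiv:1806.02777 — 6 statements merged into one kernel-verified Lean document; each statement's English description precedes it below -/
import Mathlib

section
/- The tensor induction is well defined as a representation: for every g ∈ G, writing g_i g = h_i g_{τ(i)} with h_i ∈ H and τ a permutation of {1,…,d}, the assignment ⊗-Ind(ρ)(g) : m_1 ⊗ ⋯ ⊗ m_d ↦ ρ(h_1)m_{τ(1)} ⊗ ⋯ ⊗ ρ(h_d)m_{τ(d)} defines a group homomorphism ⊗-Ind(ρ) : G → GL(M^{⊗d}). -/
open scoped TensorProduct

/-- Multiplicativity of the cocycle and permutation describing right translation on a transversal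
of right cosets. -/
theorem transversal_decomposition_mul {ι G : Type*} [Group G] {H : Subgroup G} {reps : ι → G}
    (hdisj : ∀ i j, reps i * (reps j)⁻¹ ∈ H → i = j)
    {h : G → ι → H} {τ : G → Equiv.Perm ι}
    (hdec : ∀ g i, reps i * g = (h g i : G) * reps (τ g i)) (a b : G) (i : ι) :
    τ (a * b) i = τ b (τ a i) ∧ h (a * b) i = h a i * h b (τ a i) := by
  have key : (h (a * b) i : G) * reps (τ (a * b) i) =
      h a i * h b (τ a i) * reps (τ b (τ a i)) := by
    rw [← hdec, ← mul_assoc, hdec a, mul_assoc, hdec b, mul_assoc]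
  have hτ : τ (a * b) i = τ b (τ a i) := by
    apply hdisj
    have : reps (τ (a * b) i) * (reps (τ b (τ a i)))⁻¹ =
        ((h (a * b) i)⁻¹ * (h a i * h b (τ a i)) : H) := by
      push_cast
      rw [mul_inv_eq_iff_eq_mul, mul_assoc _ _ (reps _), ← key, inv_mul_cancel_left]
    exact this ▸ SetLike.coe_mem _
  refine ⟨hτ, Subtype.ext ?_⟩
  rw [hτ] at key
  exact mul_right_cancel key

/-- Permute the factors of a tensor power by `σ`, then apply `e i` to the `i`-th factor. -/
noncomputable def PiTensorProduct.permCongr {ι A M : Type*} [CommRing A] [AddCommGroup M]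
    [Module A M] (σ : Equiv.Perm ι) (e : ι → M ≃ₗ[A] M) :
    (⨂[A] (_ : ι), M) ≃ₗ[A] (⨂[A] (_ : ι), M) :=
  (PiTensorProduct.reindex A (fun _ => M) σ.symm).trans (PiTensorProduct.congr e)

theorem PiTensorProduct.permCongr_tprod {ι A M : Type*} [CommRing A] [AddCommGroup M]
    [Module A M] (σ : Equiv.Perm ι) (e : ι → M ≃ₗ[A] M) (m : ι → M) :
    PiTensorProduct.permCongr σ e (PiTensorProduct.tprod A m) =
      PiTensorProduct.tprod A (fun i => e i (m (σ i))) := by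
  rw [permCongr, LinearEquiv.trans_apply, PiTensorProduct.reindex_tprod,
    PiTensorProduct.congr_tprod, Equiv.symm_symm]

/-- The tensor induction is well defined as a representation: the assignment
`g ↦ (m_1 ⊗ ⋯ ⊗ m_d ↦ ρ(h_1)m_{τ(1)} ⊗ ⋯ ⊗ ρ(h_d)m_{τ(d)})` defines a group homomorphism
`G → GL(M^{⊗d})`. -/
theorem tensor_induction_is_group_hom
    {A : Type*} [CommRing A] {M : Type*} [AddCommGroup M] [Module A M]
    [Module.Free A M] [Module.Finite A M]
    {G : Type*} [Group G] (H : Subgroup G) (d : ℕ) (reps : Fin d → G)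
    (hcover : ∀ x : G, ∃ i : Fin d, x * (reps i)⁻¹ ∈ H)
    (hdisj : ∀ i j : Fin d, reps i * (reps j)⁻¹ ∈ H → i = j)
    (ρ : H →* (M ≃ₗ[A] M))
    (h : G → Fin d → H) (τ : G → Equiv.Perm (Fin d))
    (hdec : ∀ (g : G) (i : Fin d), reps i * g = (h g i : G) * reps (τ g i)) :
    ∃ Φ : G →* ((⨂[A] (_ : Fin d), M) ≃ₗ[A] (⨂[A] (_ : Fin d), M)),
      ∀ (g : G) (m : Fin d → M),
        Φ g (PiTensorProduct.tprod A m) =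
          PiTensorProduct.tprod A (fun i => ρ (h g i) (m (τ g i))) := by
  refine ⟨MonoidHom.mk' (fun g => PiTensorProduct.permCongr (τ g) fun i => ρ (h g i)) fun a b => ?_,
    fun g => PiTensorProduct.permCongr_tprod _ _⟩
  apply LinearEquiv.toLinearMap_injective
  ext m
  simp only [LinearMap.compMultilinearMap_apply, LinearEquiv.coe_coe, LinearEquiv.mul_apply,
    PiTensorProduct.permCongr_tprod]
  congr 1
  funext i
  obtain ⟨hτ, hh⟩ := transversal_decomposition_mul hdisj hdec a b i
  rw [hτ, hh, map_mul, LinearEquiv.mul_apply]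
end

section
/- Let (ρ, {Ψ_σ}_{σ∈G/H}) be an object of C_{G,H}, with ρ acting on the finitely generated free A-module M. For g ∈ G, write g = h σ̃ with h ∈ H and σ the class of g in G/H, and define π(g) = ρ(h) ∘ Ψ_σ ∈ GL(M). Then π : G → GL(M) is a group homomorphism, π restricts to ρ on H, and π(σ̃) = Ψ_σ for every σ ∈ G/H. -/
/-- Given an object `(ρ, {Ψ_σ})` of `C_{G,H}`, the assignment
`π(g) = ρ(h) ∘ Ψ_σ` (for `g = h σ̃` with `h ∈ H`, `σ` the class of `g`) is a group
homomorphism `G → GL(M)` restricting to `ρ` on `H` and with `π(σ̃) = Ψ_σ`. -/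
theorem rep_from_descent_datum
    {A : Type*} [CommRing A] {M : Type*} [AddCommGroup M] [Module A M]
    [Module.Free A M] [Module.Finite A M]
    {G : Type*} [Group G] (H : Subgroup G) (hN : H.Normal) [H.FiniteIndex]
    (s : G ⧸ H → G) (hsec : ∀ σ : G ⧸ H, (s σ : G ⧸ H) = σ) (hone : s 1 = 1)
    (hmemc : ∀ (σ : G ⧸ H) (g : G), g ∈ H → s σ * g * (s σ)⁻¹ ∈ H)
    (hmem2 : ∀ σ τ : G ⧸ H, s σ * s τ * (s (σ * τ))⁻¹ ∈ H)
    (hmem3 : ∀ g : G, g * (s (g : G ⧸ H))⁻¹ ∈ H)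
    (ρ : H →* (M ≃ₗ[A] M))
    (Ψ : (G ⧸ H) → (M ≃ₗ[A] M))
    -- each `Ψ_σ` is an isomorphism of `H`-representations `ρ → σ̃*ρ`
    (hcomm : ∀ (σ : G ⧸ H) (h : G) (hh : h ∈ H) (x : M),
      Ψ σ (ρ ⟨h, hh⟩ x) = ρ ⟨s σ * h * (s σ)⁻¹, hmemc σ h hh⟩ (Ψ σ x))
    -- the cocycle condition `Ψ_σ ∘ Ψ_τ = ρ(h_{σ,τ}) ∘ Ψ_{στ}`
    (hcocycle : ∀ (σ τ : G ⧸ H) (x : M),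
      Ψ σ (Ψ τ x) = ρ ⟨s σ * s τ * (s (σ * τ))⁻¹, hmem2 σ τ⟩ (Ψ (σ * τ) x))
    -- `π(g) = ρ(h) ∘ Ψ_σ` where `g = h σ̃`
    (π : G → (M ≃ₗ[A] M))
    (hπ : ∀ (g : G) (x : M), π g x = ρ ⟨g * (s (g : G ⧸ H))⁻¹, hmem3 g⟩ (Ψ (g : G ⧸ H) x)) :
    (∀ g g' : G, π (g * g') = π g * π g') ∧ (π 1 = 1) ∧
    (∀ (h : G) (hh : h ∈ H), π h = ρ ⟨h, hh⟩) ∧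
    (∀ σ : G ⧸ H, π (s σ) = Ψ σ) := by
  have hρ_mul : ∀ (a b : G) (ha : a ∈ H) (hb : b ∈ H) (x : M),
      ρ ⟨a, ha⟩ (ρ ⟨b, hb⟩ x) = ρ ⟨a * b, H.mul_mem ha hb⟩ x := by
    intro a b ha hb x
    rw [← LinearEquiv.mul_apply, ← map_mul]
    rfl
  have hρ_one : ∀ (a : G) (ha : a ∈ H) (x : M), a = 1 → ρ ⟨a, ha⟩ x = x := by
    rintro a ha x rfl
    exact LinearEquiv.congr_fun (map_one ρ) x
  have hΨ_one : ∀ x : M, Ψ 1 x = x := by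
    intro x
    apply (Ψ 1).injective
    rw [hcocycle, hρ_one _ _ _ (by simp [hone]), mul_one]
  have hπ_eq : ∀ (g : G) (σ : G ⧸ H) (k : G) (hk : k ∈ H) (x : M),
      (g : G ⧸ H) = σ → k = g * (s σ)⁻¹ → π g x = ρ ⟨k, hk⟩ (Ψ σ x) := by
    rintro g _ _ hk x rfl rfl
    exact hπ g x
  have hπ_res : ∀ (h : G) (hh : h ∈ H), π h = ρ ⟨h, hh⟩ := by
    intro h hh
    ext x
    rw [hπ_eq h 1 h hh x ((QuotientGroup.eq_one_iff h).2 hh) (by simp [hone]), hΨ_one]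
  refine ⟨fun g g' => ?_, ?_, hπ_res, fun σ => ?_⟩
  · ext x
    rw [LinearEquiv.mul_apply, hπ g, hπ g', hcomm, hcocycle, hρ_mul, hρ_mul]
    exact hπ_eq _ _ _ _ x (QuotientGroup.mk_mul H g g') (by group)
  · rw [hπ_res 1 H.one_mem]
    exact map_one ρ
  · ext x
    rw [hπ_eq (s σ) σ 1 H.one_mem x (hsec σ) (by simp), hρ_one _ _ _ rfl]
end

section
/- Let ρ : H → GL(M) be a representation of H on a finitely generated free A-module. Let 𝓜 = ⊗_{τ∈G/H} M be the H-representation on which h ∈ H acts by ⊗_{τ∈G/H} m_τ ↦ ⊗_{τ∈G/H} ρ(τ̃ h τ̃⁻¹)(m_τ), and for each σ ∈ G/H let Ψ_σ : 𝓜 → 𝓜 be the A-linear map determined by ⊗_{τ∈G/H} m_τ ↦ ⊗_{τ∈G/H} ρ(h_{τ,σ})(m_{τσ}). Then each Ψ_σ is an isomorphism of H-representations from 𝓜 to σ̃*𝓜, and the family {Ψ_σ} satisfies the cocycle condition Ψ_σ ∘ Ψ_τ = ρ_𝓜(h_{σ,τ}) ∘ Ψ_{στ} for all σ, τ ∈ G/H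 (where ρ_𝓜 denotes the H-action on 𝓜); that is, (𝓜, {Ψ_σ}) is an object of C_{G,H}. -/
open scoped TensorProduct

/-- Two composites of operators `ρ h` agree as soon as the products of the underlying elements of
`G` agree. -/
theorem MonoidHom.apply_apply_eq_of_mul_eq {A M G : Type*} [CommRing A] [AddCommGroup M]
    [Module A M] [Group G] {H : Subgroup G} (ρ : H →* (M ≃ₗ[A] M)) {a b c d : H} {x y : M}
    (h : (a : G) * b = c * d) (hxy : x = y) : ρ a (ρ b x) = ρ c (ρ d y) := by
  have h' : a * b = c * d := Subtype.ext h
  rw [hxy, ← LinearEquiv.mul_apply, ← LinearEquiv.mul_apply, ← map_mul, ← map_mul, h']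

/-- Two linear maps on a tensor power that agree on pure tensors are equal at every point. -/
theorem PiTensorProduct.apply_eq_of_tprod {A M N ι : Type*} [CommRing A] [AddCommGroup M]
    [Module A M] [AddCommGroup N] [Module A N] {f g : (⨂[A] (_ : ι), M) →ₗ[A] N}
    (h : ∀ m : ι → M, f (PiTensorProduct.tprod A m) = g (PiTensorProduct.tprod A m))
    (x : ⨂[A] (_ : ι), M) : f x = g x :=
  LinearMap.congr_fun (PiTensorProduct.ext (MultilinearMap.ext h)) x

/-- The tensor product `𝓜 = ⊗_{τ∈G/H} τ̃*ρ` together with the permutation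
isomorphisms `Ψ_σ(⊗_τ m_τ) = ⊗_τ ρ(h_{τ,σ})(m_{τσ})` is an object of `C_{G,H}`: each
`Ψ_σ` is an isomorphism of `H`-representations `𝓜 → σ̃*𝓜` and the family `{Ψ_σ}`
satisfies the cocycle condition. -/
theorem tensor_product_descent_datum
    {A : Type*} [CommRing A] {M : Type*} [AddCommGroup M] [Module A M]
    [Module.Free A M] [Module.Finite A M]
    {G : Type*} [Group G] (H : Subgroup G) (hN : H.Normal) [H.FiniteIndex]
    (s : G ⧸ H → G) (hsec : ∀ σ : G ⧸ H, (s σ : G ⧸ H) = σ) (hone : s 1 = 1)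
    (hmemc : ∀ (σ : G ⧸ H) (g : G), g ∈ H → s σ * g * (s σ)⁻¹ ∈ H)
    (hmem2 : ∀ σ τ : G ⧸ H, s σ * s τ * (s (σ * τ))⁻¹ ∈ H)
    (ρ : H →* (M ≃ₗ[A] M))
    -- `R h` is the action of `h ∈ H` on `𝓜 = ⊗_{τ∈G/H} τ̃*M`
    (R : H → ((⨂[A] (_ : G ⧸ H), M) →ₗ[A] (⨂[A] (_ : G ⧸ H), M)))
    (hR : ∀ (h : H) (m : (G ⧸ H) → M),
      R h (PiTensorProduct.tprod A m) =
        PiTensorProduct.tprod A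
          (fun τ => ρ ⟨s τ * h * (s τ)⁻¹, hmemc τ h h.2⟩ (m τ)))
    -- `Ψ_σ` is the permutation map `⊗_τ m_τ ↦ ⊗_τ ρ(h_{τ,σ})(m_{τσ})`
    (Ψ : (G ⧸ H) → ((⨂[A] (_ : G ⧸ H), M) →ₗ[A] (⨂[A] (_ : G ⧸ H), M)))
    (hΨ : ∀ (σ : G ⧸ H) (m : (G ⧸ H) → M),
      Ψ σ (PiTensorProduct.tprod A m) =
        PiTensorProduct.tprod A
          (fun τ => ρ ⟨s τ * s σ * (s (τ * σ))⁻¹, hmem2 τ σ⟩ (m (τ * σ)))) :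
    -- each `Ψ_σ` is bijective and intertwines the `H`-action on `𝓜` with its
    -- `σ̃`-conjugate, and the family `{Ψ_σ}` satisfies the cocycle condition
    (∀ σ : G ⧸ H, Function.Bijective (Ψ σ)) ∧
    (∀ (σ : G ⧸ H) (h : G) (hh : h ∈ H) (x : ⨂[A] (_ : G ⧸ H), M),
      Ψ σ (R ⟨h, hh⟩ x) = R ⟨s σ * h * (s σ)⁻¹, hmemc σ h hh⟩ (Ψ σ x)) ∧
    (∀ (σ τ : G ⧸ H) (x : ⨂[A] (_ : G ⧸ H), M),
      Ψ σ (Ψ τ x) = R ⟨s σ * s τ * (s (σ * τ))⁻¹, hmem2 σ τ⟩ (Ψ (σ * τ) x)) := by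
  have map_eq_self {g : H} (hg : (g : G) = 1) (v : M) : ρ g v = v := by
    rw [show g = 1 from Subtype.ext hg, map_one, LinearEquiv.coe_one, id]
  have R_left_inv (h : H) : Function.LeftInverse (R h⁻¹) (R h) := by
    refine PiTensorProduct.apply_eq_of_tprod (f := R h⁻¹ ∘ₗ R h) (g := .id) fun m => ?_
    simp only [LinearMap.comp_apply, LinearMap.id_apply, hR]
    congr 1
    funext τ
    rw [← LinearEquiv.mul_apply, ← map_mul]
    exact map_eq_self (by simp) _
  have R_bijective (h : H) : Function.Bijective (R h) :=
    ⟨(R_left_inv h).injective, by simpa using (R_left_inv h⁻¹).surjective⟩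
  have Ψ_one (x : ⨂[A] (_ : G ⧸ H), M) : Ψ 1 x = x := by
    refine PiTensorProduct.apply_eq_of_tprod (f := Ψ 1) (g := .id) (fun m => ?_) x
    rw [hΨ, LinearMap.id_apply]
    congr 1
    funext τ
    rw [map_eq_self (by simp [hone]), mul_one]
  have cocycle (σ τ : G ⧸ H) (x : ⨂[A] (_ : G ⧸ H), M) :
      Ψ σ (Ψ τ x) = R ⟨s σ * s τ * (s (σ * τ))⁻¹, hmem2 σ τ⟩ (Ψ (σ * τ) x) := by
    refine PiTensorProduct.apply_eq_of_tprod (f := Ψ σ ∘ₗ Ψ τ) (g := R _ ∘ₗ Ψ (σ * τ))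
      (fun m => ?_) x
    simp only [LinearMap.comp_apply, hΨ, hR]
    congr 1
    funext κ
    exact ρ.apply_apply_eq_of_mul_eq (by simp [mul_assoc]) (by rw [mul_assoc])
  have comp_bijective {σ τ : G ⧸ H} (hστ : σ * τ = 1) : Function.Bijective (Ψ σ ∘ Ψ τ) := by
    convert R_bijective ⟨s σ * s τ * (s (σ * τ))⁻¹, hmem2 σ τ⟩ using 1
    funext x
    rw [Function.comp_apply, cocycle, show Ψ (σ * τ) x = x by rw [hστ, Ψ_one]]
  refine ⟨fun σ => ⟨(comp_bijective (inv_mul_cancel σ)).1.of_comp,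
    (comp_bijective (mul_inv_cancel σ)).2.of_comp⟩, fun σ h hh x => ?_, cocycle⟩
  refine PiTensorProduct.apply_eq_of_tprod (f := Ψ σ ∘ₗ R ⟨h, hh⟩) (g := R _ ∘ₗ Ψ σ)
    (fun m => ?_) x
  simp only [LinearMap.comp_apply, hΨ, hR]
  congr 1
  funext τ
  exact ρ.apply_apply_eq_of_mul_eq (by simp [mul_assoc]) rfl
end

section
/- Let G be a group, H a normal subgroup of finite index r such that the quotient G/H is cyclic, generated by the class of an element g ∈ G; take as coset representatives the powers 1, g, g², …, g^{r−1}. Let ρ : H → GL(V) be a representation of H on a finite-dimensional vector space V over a field K. Then g^r ∈ H and the trace of the operator ⊗-Ind(ρ)(g) on V^{⊗r} equals the trace of ρ(g^r) on V: Tr(⊗-Ind(ρ)(g)) = Tr(ρ(g^r)). -/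
open scoped TensorProduct

/-- The trace of the cyclic shift on `V^{⊗(n+1)}`, twisted by `A` in the last slot, is the trace
of `A`. -/
theorem trace_twisted_cyclic_shift_s9 {K V : Type*} [Field K] [AddCommGroup V] [Module K V]
    [FiniteDimensional K V] {n : ℕ} (A : V →ₗ[K] V)
    (T : (⨂[K] (_ : Fin (n + 1)), V) →ₗ[K] (⨂[K] (_ : Fin (n + 1)), V))
    (hT : ∀ m : Fin (n + 1) → V, T (PiTensorProduct.tprod K m) =
      PiTensorProduct.tprod K (Fin.snoc (α := fun _ => V) (fun i => m i.succ) (A (m 0)))) :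
    LinearMap.trace K _ T = LinearMap.trace K V A := by
  classical
  let b := Module.finBasis K V
  rw [LinearMap.trace_eq_matrix_trace K (Basis.piTensorProduct fun _ : Fin (n + 1) => b),
    LinearMap.trace_eq_matrix_trace K b]
  simp only [Matrix.trace, Matrix.diag_apply, LinearMap.toMatrix_apply, Basis.piTensorProduct_apply,
    hT, Basis.piTensorProduct_repr_tprod_apply, Fin.prod_univ_castSucc, Fin.snoc_castSucc,
    Fin.snoc_last, Module.Basis.repr_self]
  symm
  refine Finset.sum_of_injOn (fun c _ => c) (fun c _ d _ hcd => congrFun hcd 0) (by simp) ?_ ?_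
  · intro f _ hf
    suffices ∃ i : Fin n, f i.succ ≠ f i.castSucc by
      obtain ⟨i, hi⟩ := this
      refine mul_eq_zero_of_left (Finset.prod_eq_zero (Finset.mem_univ i) ?_) _
      exact Finsupp.single_eq_of_ne' hi
    by_contra! hconst
    refine hf ⟨f 0, by simp, funext fun i => ?_⟩
    induction i using Fin.induction with
    | zero => rfl
    | succ i ih => rw [hconst i, ← ih]
  · intro c _
    simp

/-- If `G/H` is cyclic of order `r` generated by the class of `g`, with coset
representatives `1, g, …, g^{r-1}`, then `g^r ∈ H` and the trace of `⊗-Ind(ρ)(g)` on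
`V^{⊗r}` equals the trace of `ρ(g^r)` on `V`. -/
theorem trace_tensor_induction_cyclic
    {K : Type*} [Field K] {V : Type*} [AddCommGroup V] [Module K V]
    [FiniteDimensional K V]
    {G : Type*} [Group G] (H : Subgroup G) (r : ℕ) (hr : 1 ≤ r) (g : G)
    -- `1, g, g², …, g^{r-1}` is a system of representatives of the right cosets of `H`
    (hcover : ∀ x : G, ∃ i : Fin r, x * (g ^ (i : ℕ))⁻¹ ∈ H)
    (hdisj : ∀ i j : Fin r, g ^ (i : ℕ) * (g ^ (j : ℕ))⁻¹ ∈ H → i = j)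
    (ρ : H →* (V ≃ₗ[K] V))
    -- the tensor induction data for the element `g`
    (h : Fin r → H) (τ : Equiv.Perm (Fin r))
    (hdec : ∀ i : Fin r, g ^ (i : ℕ) * g = (h i : G) * g ^ ((τ i : ℕ)))
    (T : (⨂[K] (_ : Fin r), V) →ₗ[K] (⨂[K] (_ : Fin r), V))
    (hT : ∀ m : Fin r → V,
      T (PiTensorProduct.tprod K m) =
        PiTensorProduct.tprod K (fun i => ρ (h i) (m (τ i)))) :
    g ^ r ∈ H ∧
    ∀ hgr : g ^ r ∈ H,
      LinearMap.trace K _ T = LinearMap.trace K V (ρ ⟨g ^ r, hgr⟩ : V →ₗ[K] V) := by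
  obtain ⟨n, rfl⟩ : ∃ n, r = n + 1 := ⟨r - 1, by omega⟩
  have hτ (i : Fin n) : τ i.castSucc = i.succ := by
    symm
    apply hdisj
    have := hdec i.castSucc
    rw [Fin.val_castSucc, ← pow_succ] at this
    rw [Fin.val_succ, this, mul_inv_cancel_right]
    exact (h i.castSucc).2
  have hh (i : Fin n) : h i.castSucc = 1 := by
    have := hdec i.castSucc
    rw [hτ, Fin.val_castSucc, ← pow_succ, Fin.val_succ, right_eq_mul] at this
    exact Subtype.ext this
  have hτ_last : τ (Fin.last n) = 0 := by
    obtain ⟨j, hj⟩ := τ.surjective 0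
    induction j using Fin.lastCases with
    | last => exact hj
    | cast i => exact absurd ((hτ i).symm.trans hj) (Fin.succ_ne_zero i)
  have hh_last : g ^ (n + 1) = h (Fin.last n) := by
    simpa [hτ_last, ← pow_succ] using hdec (Fin.last n)
  refine ⟨hh_last ▸ (h (Fin.last n)).2, fun hgr => trace_twisted_cyclic_shift_s9 _ T fun m => ?_⟩
  rw [hT]
  congr 1
  funext i
  induction i using Fin.lastCases with
  | last =>
    rw [Fin.snoc_last, hτ_last, show h (Fin.last n) = ⟨g ^ (n + 1), hgr⟩ from
      Subtype.ext hh_last.symm]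
    rfl
  | cast i => simp [hτ, hh]
end

section
/- Let A be a commutative ring, M a finitely generated free A-module, f : M → M an A-linear map, and r ≥ 1. Let T : M^{⊗r} → M^{⊗r} be the A-linear map determined on pure tensors by m_0 ⊗ m_1 ⊗ ⋯ ⊗ m_{r−1} ↦ m_1 ⊗ ⋯ ⊗ m_{r−1} ⊗ f(m_0). Then the trace of T on M^{⊗r} equals the trace of f on M. -/
open scoped TensorProduct

/-- the trace of the "twisted cyclic shift"
`m_0 ⊗ m_1 ⊗ ⋯ ⊗ m_{r−1} ↦ m_1 ⊗ ⋯ ⊗ m_{r−1} ⊗ f(m_0)` on `M^{⊗r}` equals the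
trace of `f` on `M`. -/
theorem trace_twisted_cyclic_shift
    {A : Type*} [CommRing A] {M : Type*} [AddCommGroup M] [Module A M]
    [Module.Free A M] [Module.Finite A M]
    (f : M →ₗ[A] M) (r : ℕ) (hr : 1 ≤ r)
    (T : (⨂[A] (_ : Fin r), M) →ₗ[A] (⨂[A] (_ : Fin r), M))
    (hT : ∀ m : Fin r → M,
      T (PiTensorProduct.tprod A m) =
        PiTensorProduct.tprod A
          (fun i : Fin r =>
            if h : (i : ℕ) + 1 < r then m ⟨(i : ℕ) + 1, h⟩ else f (m ⟨0, hr⟩))) :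
    LinearMap.trace A _ T = LinearMap.trace A M f := by
  classical
  obtain ⟨n, rfl⟩ : ∃ n, r = n + 1 := ⟨r - 1, by omega⟩
  let b := Module.Free.chooseBasis A M
  have diag_entry (p : Fin (n + 1) → Module.Free.ChooseBasisIndex A M) :
      LinearMap.toMatrix (Basis.piTensorProduct fun _ => b) (Basis.piTensorProduct fun _ => b)
          T p p =
        (∏ i : Fin n, if p i.succ = p i.castSucc then 1 else 0) *
          b.repr (f (b (p 0))) (p (Fin.last n)) := by
    rw [LinearMap.toMatrix_apply, Basis.piTensorProduct_apply, hT,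
      Basis.piTensorProduct_repr_tprod_apply, Fin.prod_univ_castSucc]
    congr 1
    · refine Finset.prod_congr rfl fun i _ => ?_
      rw [dif_pos (by simp)]
      exact b.repr_self_apply _ _
    · rw [dif_neg (by simp)]
      rfl
  rw [LinearMap.trace_eq_matrix_trace A (Basis.piTensorProduct fun _ => b),
    LinearMap.trace_eq_matrix_trace A b]
  symm
  refine Finset.sum_of_injOn (fun c _ => c) (fun c _ d _ h => congrFun h 0) (by simp)
    (fun p _ hp => ?_) (fun c _ => ?_)
  · rw [Matrix.diag_apply, diag_entry]
    by_cases h : ∀ i : Fin n, p i.succ = p i.castSucc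
    · refine absurd ⟨p 0, by simp, funext fun i => ?_⟩ hp
      induction i using Fin.induction with
      | zero => rfl
      | succ i ih => exact ih.trans (h i).symm
    · push Not at h
      obtain ⟨i, hi⟩ := h
      rw [Finset.prod_eq_zero (Finset.mem_univ i) (if_neg hi), zero_mul]
  · rw [Matrix.diag_apply, Matrix.diag_apply, diag_entry, LinearMap.toMatrix_apply]
    simp
end

section
/- Let K be a field, (P^i)_{i∈ℤ} a family of finite-dimensional K-vector spaces which are zero for all but finitely many i, and f = (f^i : P^i → P^i)_{i∈ℤ} a family of linear maps. Fix r ≥ 1 and for m ∈ ℤ set Q^m = ⊕_{i_0+⋯+i_{r−1}=m} P^{i_0} ⊗ ⋯ ⊗ P^{i_{r−1}}, with T : Q^m → Q^m the linear map sending a pure tensor m_0 ⊗ ⋯ ⊗ m_{r−1} ∈ P^{i_0} ⊗ ⋯ ⊗ P^{i_{r−1}} to (−1)^{i_0(i_1+⋯+i_{r−1})} · m_1 ⊗ ⋯ ⊗ m_{r−1} ⊗ f^{i_0}(m_0) ∈ P^{i_1} ⊗ ⋯ ⊗ P^{i_{r−1}} ⊗ P^{i_0}. Then: (a) Tr(T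 | Q^m) = 0 if r does not divide m, and Tr(T | Q^{ir}) = (−1)^{i(r−1)} Tr(f^i | P^i) for every i ∈ ℤ; consequently (b) ∑_m (−1)^m Tr(T | Q^m) = ∑_i (−1)^i Tr(f^i | P^i). -/
open scoped TensorProduct DirectSum

open Module

/-- The trace of an endomorphism of a direct sum, computed in bases of the summands. -/
theorem LinearMap.trace_directSum_eq_sum_repr {K ι : Type*} [Field K] [DecidableEq ι]
    {M : ι → Type*} [∀ i, AddCommGroup (M i)] [∀ i, Module K (M i)] {κ : ι → Type*}
    (B : ∀ i, Basis (κ i) K (M i)) [Fintype (Σ i, κ i)] (T : (⨁ i, M i) →ₗ[K] ⨁ i, M i) :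
    LinearMap.trace K _ T =
      ∑ p : Σ i, κ i, (B p.1).repr (T (DirectSum.lof K ι M p.1 (B p.1 p.2)) p.1) p.2 := by
  classical
  let D : Basis (Σ i, κ i) K (⨁ i, M i) := DFinsupp.basis B
  have hrepr (x : ⨁ i, M i) (p : Σ i, κ i) : D.repr x p = (B p.1).repr (x p.1) p.2 := rfl
  have hD (p : Σ i, κ i) : D p = DirectSum.lof K ι M p.1 (B p.1 p.2) := by
    refine D.repr.injective (Finsupp.ext fun q => ?_)
    rw [Basis.repr_self, hrepr]
    obtain ⟨i, k⟩ := p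
    obtain ⟨j, l⟩ := q
    by_cases hij : i = j
    · subst hij
      simp [DirectSum.lof_apply, Finsupp.single_apply]
    · have hne : (⟨i, k⟩ : Σ i, κ i) ≠ ⟨j, l⟩ := fun h => hij (congrArg Sigma.fst h)
      rw [Finsupp.single_eq_of_ne' hne]
      simp [DirectSum.lof_eq_of, DirectSum.of_eq_of_ne _ _ _ (Ne.symm hij)]
  rw [LinearMap.trace_eq_matrix_trace K D, Matrix.trace]
  refine Finset.sum_congr rfl fun p _ => ?_
  rw [Matrix.diag_apply, LinearMap.toMatrix_apply, hrepr, hD]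

theorem Fin.apply_eq_apply_zero_of_apply_add_one {α : Type*} {r : ℕ} [NeZero r] {e : Fin r → α}
    (h : ∀ j, j + 1 ≠ 0 → e (j + 1) = e j) (j : Fin r) : e j = e 0 := by
  obtain ⟨n, rfl⟩ := Nat.exists_eq_succ_of_ne_zero (NeZero.ne r)
  induction j using Fin.induction with
  | zero => rfl
  | succ i ih =>
    rw [← ih, ← h i.castSucc, Fin.coeSucc_eq_succ]
    rw [Fin.coeSucc_eq_succ]
    exact Fin.succ_ne_zero i

section ShiftCoefficient

variable {K V κ : Type*} [Field K] [AddCommGroup V] [Module K V] (b : Basis κ K V)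
  (f : V →ₗ[K] V) {r : ℕ} [NeZero r]

theorem prod_repr_shift_const (k : κ) :
    ∏ j : Fin r, b.repr (if j + 1 = 0 then f (b k) else b k) k = b.repr (f (b k)) k := by
  rw [Finset.prod_eq_single (-1)]
  · simp
  · intro j _ hj
    rw [if_neg fun h => hj (eq_neg_of_add_eq_zero_left h)]
    simp
  · simp

theorem eq_const_of_prod_repr_shift_ne_zero {e : Fin r → κ}
    (h : ∏ j : Fin r, b.repr (if j + 1 = 0 then f (b (e (j + 1))) else b (e (j + 1))) (e j) ≠ 0)
    (j : Fin r) : e j = e 0 := by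
  refine Fin.apply_eq_apply_zero_of_apply_add_one (fun j hj => ?_) j
  by_contra hne
  refine h (Finset.prod_eq_zero (Finset.mem_univ j) ?_)
  rw [if_neg hj, Basis.repr_self, Finsupp.single_eq_of_ne' hne]

end ShiftCoefficient

theorem finite_sigma_fin_finrank {K ι : Type*} [Field K] {P : ι → Type*}
    [∀ i, AddCommGroup (P i)] [∀ i, Module K (P i)] [∀ i, FiniteDimensional K (P i)]
    (hsupp : {i | Nontrivial (P i)}.Finite) : Finite (Σ i, Fin (finrank K (P i))) := by
  have := hsupp.to_subtype
  refine Finite.of_injective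
    (β := Σ i : {i | Nontrivial (P i)}, Fin (finrank K (P i)))
    (fun p => ⟨⟨p.1, finrank_pos_iff.1 p.2.pos⟩, p.2⟩) ?_
  rintro ⟨i, k⟩ ⟨j, l⟩ h
  have hij : i = j := congrArg (fun q => q.1.1) h
  subst hij
  simpa using h

theorem finite_sigma_pi {ι α : Type*} [Finite ι] {κ : α → Type*} [Finite (Σ i, κ i)]
    (p : (ι → α) → Prop) : Finite (Σ v : {v : ι → α // p v}, ∀ j, κ (v.1 j)) := by
  refine Finite.of_injective (β := ι → Σ i, κ i) (fun q j => ⟨q.1.1 j, q.2 j⟩) ?_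
  rintro ⟨⟨v, hv⟩, e⟩ ⟨⟨w, hw⟩, e'⟩ h
  have hvw : v = w := funext fun j => congrArg Sigma.fst (congrFun h j)
  subst hvw
  have he : e = e' := funext fun j => eq_of_heq (Sigma.mk.inj (congrFun h j)).2
  rw [he]

theorem neg_one_zpow_mul_self_mul {K : Type*} [Field K] (i n : ℤ) :
    (-1 : K) ^ (i * (i * n)) = (-1) ^ (i * n) := by
  simp [neg_one_zpow_eq_ite, Int.even_mul]

/-- the graded trace of the signed twisted cyclic shift on
`Q^m = ⊕_{i_0+⋯+i_{r−1}=m} P^{i_0} ⊗ ⋯ ⊗ P^{i_{r−1}}` vanishes unless `r ∣ m`, equals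
`(−1)^{i(r−1)} Tr(f^i | P^i)` for `m = ir`, and consequently
`∑_m (−1)^m Tr(T | Q^m) = ∑_i (−1)^i Tr(f^i | P^i)`. -/
theorem trace_graded_twisted_cyclic_shift
    {K : Type*} [Field K] (P : ℤ → Type*)
    [∀ i, AddCommGroup (P i)] [∀ i, Module K (P i)] [∀ i, FiniteDimensional K (P i)]
    (hsupp : {i : ℤ | Nontrivial (P i)}.Finite)
    (f : ∀ i : ℤ, P i →ₗ[K] P i)
    (r : ℕ) [NeZero r]
    (T : ∀ m : ℤ,
      (⨁ v : {v : Fin r → ℤ // ∑ j, v j = m}, ⨂[K] j : Fin r, P (v.1 j)) →ₗ[K]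
      (⨁ v : {v : Fin r → ℤ // ∑ j, v j = m}, ⨂[K] j : Fin r, P (v.1 j)))
    (hT : ∀ (m : ℤ) (v : {v : Fin r → ℤ // ∑ j, v j = m})
        (hv' : ∑ j, v.1 (j + 1) = m) (x : ∀ j : Fin r, P (v.1 j)),
      T m (DirectSum.lof K {v : Fin r → ℤ // ∑ j, v j = m}
          (fun v : {v : Fin r → ℤ // ∑ j, v j = m} => ⨂[K] j : Fin r, P (v.1 j)) v
          (PiTensorProduct.tprod K x)) =
        ((-1 : K) ^ (v.1 0 * (m - v.1 0))) •
          DirectSum.lof K {v : Fin r → ℤ // ∑ j, v j = m}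
            (fun v : {v : Fin r → ℤ // ∑ j, v j = m} => ⨂[K] j : Fin r, P (v.1 j))
            ⟨fun j => v.1 (j + 1), hv'⟩
            (PiTensorProduct.tprod K
              (fun j => if j + 1 = 0 then f (v.1 (j + 1)) (x (j + 1)) else x (j + 1)))) :
    (∀ m : ℤ, ¬ ((r : ℤ) ∣ m) → LinearMap.trace K _ (T m) = 0) ∧
    (∀ i : ℤ, LinearMap.trace K _ (T (i * r)) =
      (-1 : K) ^ (i * ((r : ℤ) - 1)) * LinearMap.trace K (P i) (f i)) ∧
    (∑ᶠ m : ℤ, (-1 : K) ^ m * LinearMap.trace K _ (T m) =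
      ∑ᶠ i : ℤ, (-1 : K) ^ i * LinearMap.trace K (P i) (f i)) := by
  classical
  let b : ∀ i, Basis (Fin (finrank K (P i))) K (P i) := fun i => finBasis K (P i)
  have := finite_sigma_fin_finrank (K := K) hsupp
  have hfin (m : ℤ) : Finite (Σ v : {v : Fin r → ℤ // ∑ j, v j = m},
      ∀ j, Fin (finrank K (P (v.1 j)))) :=
    finite_sigma_pi (κ := fun i => Fin (finrank K (P i))) _
  have (m : ℤ) := Fintype.ofFinite (Σ v : {v : Fin r → ℤ // ∑ j, v j = m},
      ∀ j, Fin (finrank K (P (v.1 j))))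
  let B (m : ℤ) (v : {v : Fin r → ℤ // ∑ j, v j = m}) :=
    Basis.piTensorProduct fun j => b (v.1 j)
  let c (m : ℤ) (p : Σ v : {v : Fin r → ℤ // ∑ j, v j = m},
      ∀ j, Fin (finrank K (P (v.1 j)))) : K :=
    (B m p.1).repr (T m (DirectSum.lof K _ _ p.1 (B m p.1 p.2)) p.1) p.2
  have htrace (m : ℤ) : LinearMap.trace K _ (T m) = ∑ p, c m p :=
    LinearMap.trace_directSum_eq_sum_repr (B m) (T m)
  have hshift {m : ℤ} (v : {v : Fin r → ℤ // ∑ j, v j = m}) : ∑ j, v.1 (j + 1) = m :=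
    (Equiv.sum_comp (Equiv.addRight (1 : Fin r)) v.1).trans v.2
  have hconst {m : ℤ} {p} (hp : c m p ≠ 0) (j : Fin r) : p.1.1 j = p.1.1 0 := by
    refine Fin.apply_eq_apply_zero_of_apply_add_one (fun j _ => ?_) j
    by_contra hne
    apply hp
    have hv : p.1 ≠ ⟨fun j => p.1.1 (j + 1), hshift p.1⟩ := fun h =>
      hne (congrFun (congrArg Subtype.val h) j).symm
    simp only [c, B, Basis.piTensorProduct_apply]
    rw [hT m p.1 (hshift p.1), DirectSum.smul_apply, DirectSum.lof_eq_of,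
      DirectSum.of_eq_of_ne _ _ _ hv]
    simp
  have hc (m i : ℤ) (hi : ∑ _j : Fin r, i = m) (e : Fin r → Fin (finrank K (P i))) :
      c m ⟨⟨fun _ => i, hi⟩, e⟩ = (-1 : K) ^ (i * ((r : ℤ) - 1)) *
        ∏ j : Fin r, (b i).repr
          (if j + 1 = 0 then f i (b i (e (j + 1))) else b i (e (j + 1))) (e j) := by
    simp only [c, B, Basis.piTensorProduct_apply]
    rw [hT m ⟨fun _ => i, hi⟩ hi, DirectSum.smul_apply, DirectSum.lof_apply, map_smul,
      Finsupp.smul_apply, Basis.piTensorProduct_repr_tprod_apply, smul_eq_mul]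
    congr 1
    have hm : m - i = i * ((r : ℤ) - 1) := by
      rw [← hi]
      simp
      ring
    rw [hm, neg_one_zpow_mul_self_mul]
  have hzero (m : ℤ) (hm : ¬ (r : ℤ) ∣ m) : LinearMap.trace K _ (T m) = 0 := by
    rw [htrace]
    refine Finset.sum_eq_zero fun p _ => ?_
    by_contra hp
    refine hm ⟨p.1.1 0, ?_⟩
    refine p.1.2.symm.trans ((Finset.sum_congr rfl fun j _ => hconst hp j).trans ?_)
    simp
  have hmul (i : ℤ) : LinearMap.trace K _ (T (i * r)) =
      (-1 : K) ^ (i * ((r : ℤ) - 1)) * LinearMap.trace K (P i) (f i) := by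
    have hi : ∑ _j : Fin r, i = i * r := by simp [mul_comm]
    rw [htrace, LinearMap.trace_eq_matrix_trace K (b i), Matrix.trace, Finset.mul_sum]
    symm
    refine Fintype.sum_of_injective (fun k => ⟨⟨fun _ => i, hi⟩, fun _ => k⟩) ?_ _ _ ?_ ?_
    · intro k l h
      simpa [funext_iff] using h
    · rintro ⟨⟨v, hv⟩, e⟩ hp
      by_contra hne
      apply hp
      have hv0 : v = fun _ => v 0 := funext (hconst hne)
      have hvi : v 0 = i := by
        rw [hv0] at hv
        have h : (r : ℤ) * v 0 = r * i := by simpa [mul_comm i] using hv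
        exact mul_left_cancel₀ (Nat.cast_ne_zero.2 (NeZero.ne r)) h
      rw [hvi] at hv0
      subst hv0
      rw [hc] at hne
      have he := eq_const_of_prod_repr_shift_ne_zero _ _ (right_ne_zero_of_mul hne)
      exact ⟨e 0, by simp only [Sigma.mk.injEq, heq_eq_eq, true_and]; exact (funext he).symm⟩
    · intro k
      rw [hc, prod_repr_shift_const, Matrix.diag_apply, LinearMap.toMatrix_apply]
  refine ⟨hzero, hmul, ?_⟩
  have hr : (r : ℤ) ≠ 0 := Nat.cast_ne_zero.2 (NeZero.ne r)
  have hinj : Function.Injective fun i : ℤ => i * (r : ℤ) := mul_left_injective₀ hr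
  have hsub : (Function.support fun m : ℤ => (-1 : K) ^ m * LinearMap.trace K _ (T m)) ⊆
      Set.range fun i : ℤ => i * (r : ℤ) := by
    intro m hm
    by_contra h
    refine hm ?_
    have : ¬ (r : ℤ) ∣ m := fun ⟨i, hi⟩ => h ⟨i, by simp [hi, mul_comm]⟩
    simp [hzero m this]
  rw [← finsum_mem_univ, ← finsum_mem_inter_support_eq' _ (Set.range fun i : ℤ => i * (r : ℤ)) _
    (fun m hm => by simpa using hsub hm), finsum_mem_range hinj]
  refine finsum_congr fun i => ?_
  rw [hmul, ← mul_assoc, ← zpow_add₀ (by simp)]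
  congr 1
  have : i * (r : ℤ) + i * (r - 1) = 2 * (i * (r - 1)) + i := by ring
  rw [this, zpow_add₀ (by simp), (even_two_mul _).neg_one_zpow, one_mul]
end
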